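/- Uniformly distributed coefficients satisfy the genericity (vanishing contraction) condition (Lemma B.3). Fix an integer k ≥ 2 and constants C > 0 and c' ∈ (0,1/2). If β is uniformly distributed on the unit sphere of ℝ^{B_{d,k}}, then there exists d₀ (depending only on k, C, c') such that for all d ≥ d₀, with probability at least 1 − d^{−C}, one has ‖ι(β) ⊗_r ι(β)‖_F ≤ d^{−c'} for every r = 1, …, k−1. -/

import Mathlib

/-!
Uniformly distributed coefficients satisfy the genericity (vanishing contraction)
condition (Lemma B.3).
-/

noncomputable section

open MeasureTheory ProbabilityTheory

/-- Multi-indices on `Fin d` of total degree `k`. -/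
abbrev MIdx (d k : ℕ) : Type :=
  {κ : Fin d → ℕ // κ ∈ Finset.Nat.antidiagonalTuple d k}

/-- Euclidean norm on `ι → ℝ`. -/
def enorm2 {ι : Type*} [Fintype ι] (u : ι → ℝ) : ℝ := Real.sqrt (∑ i, (u i) ^ 2)

/-- The standard Gaussian measure on `ι → ℝ`. -/
def stdG (ι : Type*) [Fintype ι] : Measure (ι → ℝ) :=
  Measure.pi fun _ => gaussianReal 0 1

/-- The uniform distribution on the unit sphere of `ι → ℝ`. -/
def unifSphere (ι : Type*) [Fintype ι] : Measure (ι → ℝ) :=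
  (stdG ι).map fun x => (enorm2 x)⁻¹ • x

/-- `typeOf i` records how many times each value of `Fin d` occurs in the tuple `i`. -/
def typeOf {k d : ℕ} (i : Fin k → Fin d) : Fin d → ℕ :=
  fun a => (Finset.univ.filter fun t => i t = a).card

/-- The isometric embedding `ι : ℝ^{B_{d,k}} → (ℝ^d)^{⊗k}` into symmetric `k`-tensors:
`ι(v)_𝐢 = (k!/(k₁!⋯k_d!))^{-1/2} v_𝐤` whenever `type(𝐢) = 𝐤`. -/
def iotaT (d k : ℕ) (v : MIdx d k → ℝ) : (Fin k → Fin d) → ℝ :=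
  fun i =>
    if h : typeOf i ∈ Finset.Nat.antidiagonalTuple d k then
      Real.sqrt ((∏ a, (Nat.factorial (typeOf i a) : ℝ)) / (Nat.factorial k : ℝ)) *
        v ⟨typeOf i, h⟩
    else 0

/-- Combine a tuple of `k - r` free indices with a tuple of `r` contracted indices. -/
def splitIdx (d k r : ℕ) (i : Fin (k - r) → Fin d) (a : Fin r → Fin d) : Fin k → Fin d :=
  fun t => if h : (t : ℕ) < k - r then i ⟨t, h⟩ else a ⟨(t : ℕ) - (k - r), by omega⟩

/-- The squared Frobenius norm `‖S ⊗_r T‖_F²` of the contraction over `r` indices. -/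
def contrNormSq (d k r : ℕ) (S T : (Fin k → Fin d) → ℝ) : ℝ :=
  ∑ ij : (Fin (k - r) → Fin d) × (Fin (k - r) → Fin d),
    (∑ a : Fin r → Fin d, S (splitIdx d k r ij.1 a) * T (splitIdx d k r ij.2 a)) ^ 2


instance stdG_prob (ι : Type*) [Fintype ι] : IsProbabilityMeasure (stdG ι) := by
  unfold stdG; infer_instance

lemma indep_eval (ι : Type*) [Fintype ι] :
    iIndepFun (fun (i : ι) (g : ι → ℝ) => g i) (stdG ι) :=
  iIndepFun_pi (X := fun _ => id) (fun _ => aemeasurable_id)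

lemma stdG_map_eval (ι : Type*) [Fintype ι] (i : ι) :
    (stdG ι).map (fun g => g i) = gaussianReal 0 1 :=
  (measurePreserving_eval (fun _ : ι => gaussianReal 0 1) i).map_eq

lemma integral_odd (φ : ℝ → ℝ) (hφ : Measurable φ) (hodd : ∀ t, φ (-t) = - φ t) :
    ∫ t, φ t ∂(gaussianReal 0 1) = 0 := by
  have h1 : ∫ t, φ t ∂(gaussianReal 0 1) = ∫ t, φ (-t) ∂(gaussianReal 0 1) := by
    conv_lhs => rw [← neg_zero, ← gaussianReal_map_neg]
    rw [integral_map (by fun_prop) hφ.aestronglyMeasurable]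
  simp only [hodd] at h1
  rw [integral_neg] at h1
  linarith

lemma subG_one {ι : Type*} [Fintype ι] (φ : ℝ → ℝ) (hφ : Measurable φ)
    (hodd : ∀ t, φ (-t) = - φ t) (K : ℝ) (hK : ∀ t, |φ t| ≤ K) (x y : ι) (hxy : x ≠ y)
    (c : ℝ) (A : NNReal) (hA : |c| * K ^ 2 ≤ A) :
    HasSubgaussianMGF (fun g : ι → ℝ => c * (φ (g x) * φ (g y))) (A ^ 2) (stdG ι) := by
  have hK0 : 0 ≤ K := (abs_nonneg _).trans (hK 0)
  have key : HasSubgaussianMGF (fun g : ι → ℝ => c * (φ (g x) * φ (g y)))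
      ((‖(A : ℝ) - (-A : ℝ)‖₊ / 2) ^ 2) (stdG ι) := by
    apply hasSubgaussianMGF_of_mem_Icc_of_integral_eq_zero
    · fun_prop
    · refine ae_of_all _ fun g => ?_
      rw [Set.mem_Icc, ← abs_le]
      rw [abs_mul, abs_mul]
      refine le_trans ?_ hA
      have := mul_le_mul (hK (g x)) (hK (g y)) (abs_nonneg _) hK0
      rw [pow_two]
      exact mul_le_mul_of_nonneg_left this (abs_nonneg _)
    · have hi : IndepFun (fun g : ι → ℝ => φ (g x)) (fun g : ι → ℝ => φ (g y)) (stdG ι) :=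
        ((indep_eval ι).indepFun hxy).comp hφ hφ
      rw [integral_const_mul]
      have := hi.integral_fun_mul_eq_mul_integral
        (hφ.comp (measurable_pi_apply x)).aestronglyMeasurable
        (hφ.comp (measurable_pi_apply y)).aestronglyMeasurable
      rw [this]
      have h0 : ∫ g, φ (g x) ∂(stdG ι) = 0 := by
        rw [← integral_odd φ hφ hodd, ← stdG_map_eval ι x,
          integral_map (measurable_pi_apply x).aemeasurable hφ.aestronglyMeasurable]
      rw [h0]; simp
  have e : ((‖(A : ℝ) - (-A : ℝ)‖₊ / 2) ^ 2) = A ^ 2 := by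
    congr 1
    ext
    simp
    rw [abs_of_nonneg (by positivity)]; ring
  rwa [e] at key

lemma subG_sum {ι J : Type*} [Fintype ι] (φ : ℝ → ℝ) (hφ : Measurable φ)
    (hodd : ∀ t, φ (-t) = - φ t) (K : ℝ) (hK : ∀ t, |φ t| ≤ K) (x y : J → ι)
    (c : J → ℝ) (A : NNReal) (hA : ∀ α, |c α| * K ^ 2 ≤ A) (s : Finset J)
    (hxy : ∀ α ∈ s, x α ≠ y α)
    (hd : ∀ α ∈ s, ∀ β ∈ s, α ≠ β → x α ≠ x β ∧ x α ≠ y β ∧ y α ≠ y β) :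
    HasSubgaussianMGF (fun g : ι → ℝ => ∑ α ∈ s, c α * (φ (g (x α)) * φ (g (y α))))
      (s.card * A ^ 2) (stdG ι) := by
  classical
  induction s using Finset.induction_on with
  | empty => simp
  | insert i s his ih =>
    simp_rw [Finset.sum_insert his]
    rw [Finset.card_insert_of_notMem his]
    have e : ((s.card + 1 : ℕ) : NNReal) * A ^ 2 = A ^ 2 + s.card * A ^ 2 := by
      push_cast; ring
    rw [e]
    refine HasSubgaussianMGF.add_of_indepFun
      (subG_one φ hφ hodd K hK _ _ (hxy i (by simp)) _ A (hA i))
      (ih (fun α h => hxy α (by simp [h])) (fun α h β h' => hd α (by simp [h]) β (by simp [h']))) ?_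
    let S : Finset ι := {x i, y i}
    let T : Finset ι := s.image x ∪ s.image y
    have hST : Disjoint S T := by
      rw [Finset.disjoint_left]
      intro a ha hb
      simp only [S, T, Finset.mem_insert, Finset.mem_singleton, Finset.mem_union,
        Finset.mem_image] at ha hb
      have h1 : ∀ β ∈ s, x i ≠ x β ∧ x i ≠ y β ∧ y i ≠ y β := fun β hβ =>
        hd i (by simp) β (by simp [hβ]) (by rintro rfl; exact his hβ)
      have h2 : ∀ β ∈ s, x β ≠ y i := fun β hβ =>
        (hd β (by simp [hβ]) i (by simp) (by rintro rfl; exact his hβ)).2.1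
      rcases ha with rfl | rfl <;> rcases hb with ⟨β, hβ, hb⟩ | ⟨β, hβ, hb⟩
      · exact (h1 β hβ).1 hb.symm
      · exact (h1 β hβ).2.1 hb.symm
      · exact h2 β hβ hb
      · exact (h1 β hβ).2.2 hb.symm
    have hI := (indep_eval ι).indepFun_finset S T hST (fun i => measurable_pi_apply i)
    let F : (S → ℝ) → ℝ := fun u =>
      c i * (φ (u ⟨x i, by simp [S]⟩) * φ (u ⟨y i, by simp [S]⟩))
    let G : (T → ℝ) → ℝ := fun u => ∑ α ∈ s.attach,
      c α.1 * (φ (u ⟨x α.1, by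
          simp only [T, Finset.mem_union, Finset.mem_image]; exact Or.inl ⟨_, α.2, rfl⟩⟩) *
        φ (u ⟨y α.1, by
          simp only [T, Finset.mem_union, Finset.mem_image]; exact Or.inr ⟨_, α.2, rfl⟩⟩))
    have hF : Measurable F := by fun_prop
    have hG : Measurable G := by fun_prop
    have := hI.comp hF hG
    have e2 : (fun g : ι → ℝ => ∑ α ∈ s, c α * (φ (g (x α)) * φ (g (y α)))) =
        G ∘ fun g (i : T) => g i := by
      funext g
      simp only [G, Function.comp]
      exact (Finset.sum_attach s (fun α => c α * (φ (g (x α)) * φ (g (y α))))).symm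
    rw [e2]
    exact this

lemma tail_sum {ι J : Type*} [Fintype ι] (φ : ℝ → ℝ) (hφ : Measurable φ)
    (hodd : ∀ t, φ (-t) = - φ t) (K : ℝ) (hK : ∀ t, |φ t| ≤ K) (x y : J → ι)
    (c : J → ℝ) (A : NNReal) (hA : ∀ α, |c α| * K ^ 2 ≤ A) (s : Finset J)
    (hxy : ∀ α ∈ s, x α ≠ y α)
    (hd : ∀ α ∈ s, ∀ β ∈ s, α ≠ β → x α ≠ x β ∧ x α ≠ y β ∧ y α ≠ y β)
    (N : ℝ) (hN : (s.card : ℝ) ≤ N) (hA0 : 0 < A) (hN0 : 0 < N)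
    (t : ℝ) (ht : 0 < t) :
    (stdG ι).real {g | t * (Real.sqrt N * A) ≤
      |∑ α ∈ s, c α * (φ (g (x α)) * φ (g (y α)))|} ≤ 2 * Real.exp (- t ^ 2 / 2) := by
  have hA0' : (0 : ℝ) < A := by exact_mod_cast hA0
  rcases s.eq_empty_or_nonempty with rfl | hne
  · have he : {g : ι → ℝ | t * (Real.sqrt N * A) ≤
      |∑ α ∈ (∅ : Finset J), c α * (φ (g (x α)) * φ (g (y α)))|} = ∅ := by
      apply Set.eq_empty_of_forall_notMem
      intro g hg
      simp only [Finset.sum_empty, abs_zero, Set.mem_ofPred_eq] at hg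
      have : 0 < t * (Real.sqrt N * A) := by positivity
      linarith
    rw [he]; simp [Real.exp_nonneg]
  have hs := hne.card_pos
  have h := subG_sum φ hφ hodd K hK x y c A hA s hxy hd
  have hs' : (0 : ℝ) < s.card := by exact_mod_cast hs
  set X := fun g : ι → ℝ => ∑ α ∈ s, c α * (φ (g (x α)) * φ (g (y α))) with hX
  have hε : 0 ≤ t * (Real.sqrt N * A) := by positivity
  have h1 := h.measure_ge_le hε
  have h2 := h.neg.measure_ge_le hε
  have hb : Real.exp (-(t * (Real.sqrt N * A)) ^ 2 / (2 * ((s.card * A ^ 2 : NNReal) : ℝ)))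
      ≤ Real.exp (- t ^ 2 / 2) := by
    apply Real.exp_le_exp.mpr
    push_cast
    rw [mul_pow, mul_pow, Real.sq_sqrt hN0.le, neg_div, neg_div, neg_le_neg_iff,
      div_le_div_iff₀ (by norm_num) (by positivity)]
    have : 0 ≤ t ^ 2 * A ^ 2 := by positivity
    nlinarith [mul_le_mul_of_nonneg_left hN this]
  have hsub : {g | t * (Real.sqrt N * A) ≤ |X g|} ⊆
      {g | t * (Real.sqrt N * A) ≤ X g} ∪ {g | t * (Real.sqrt N * A) ≤ (-X) g} := by
    intro g hg
    simp only [Set.mem_ofPred_eq, Set.mem_union, Pi.neg_apply] at hg ⊢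
    exact le_abs.mp hg
  calc _ ≤ _ := measureReal_mono hsub (measure_ne_top _ _)
    _ ≤ _ := measureReal_union_le _ _
    _ ≤ _ := by rw [two_mul]; exact add_le_add (h1.trans hb) (h2.trans hb)

lemma tail_gauss {ι : Type*} [Fintype ι] (i : ι) (t : ℝ) (ht : 0 ≤ t) :
    (stdG ι).real {g | t ≤ |g i|} ≤ 2 * Real.exp (- t ^ 2 / 2) := by
  have h : HasSubgaussianMGF (fun x : ℝ => x) 1 (gaussianReal 0 1) :=
    ⟨fun t => integrable_exp_mul_gaussianReal t, fun t => by
      rw [mgf_fun_id_gaussianReal]; simp⟩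
  have h' : HasSubgaussianMGF (fun g : ι → ℝ => g i) 1 (stdG ι) := by
    have := stdG_map_eval ι i
    rw [← this] at h
    exact HasSubgaussianMGF.of_map (Y := fun g : ι → ℝ => g i) (X := fun x : ℝ => x)
      (measurable_pi_apply i).aemeasurable h
  have h1 := h'.measure_ge_le ht
  have h2 := h'.neg.measure_ge_le ht
  have hsub : {g : ι → ℝ | t ≤ |g i|} ⊆
      {g | t ≤ g i} ∪ {g | t ≤ (-(fun g : ι → ℝ => g i)) g} := by
    intro g hg
    simp only [Set.mem_ofPred_eq, Set.mem_union, Pi.neg_apply] at hg ⊢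
    exact le_abs.mp hg
  calc _ ≤ _ := measureReal_mono hsub (measure_ne_top _ _)
    _ ≤ _ := measureReal_union_le _ _
    _ ≤ _ := by rw [two_mul]; simpa using add_le_add h1 h2

lemma exists_lower : ∃ c : ℝ, 0 < c ∧ ∀ (ι : Type) [Fintype ι],
    (stdG ι).real {g | ∑ i, (g i) ^ 2 ≤ c * Fintype.card ι} ≤
      Real.exp (- c * Fintype.card ι) := by
  set ρ : ℝ := ∫ t, Real.exp (- t ^ 2) ∂(gaussianReal 0 1) with hρ
  have hint : Integrable (fun t : ℝ => Real.exp (- t ^ 2)) (gaussianReal 0 1) := by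
    refine Integrable.of_bound (by fun_prop) 1 (ae_of_all _ fun t => ?_)
    rw [Real.norm_eq_abs, abs_of_nonneg (Real.exp_pos _).le]
    exact Real.exp_le_one_iff.mpr (by nlinarith [sq_nonneg t])
  have hρ0 : 0 < ρ := integral_exp_pos hint
  have hρ1 : ρ < 1 := by
    have hpos : 0 < ∫ t, (1 - Real.exp (- t ^ 2)) ∂(gaussianReal 0 1) := by
      rw [integral_pos_iff_support_of_nonneg]
      · have : (Function.support fun t : ℝ => 1 - Real.exp (- t ^ 2)) = {0}ᶜ := by
          ext t
          rw [Function.mem_support, Set.mem_compl_iff, Set.mem_singleton_iff, not_iff_not,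
            sub_eq_zero, eq_comm, Real.exp_eq_one_iff]
          simp
        rw [this]
        have hn := nullSingletonClass_gaussianReal (μ := 0) (v := 1) one_ne_zero
        rw [prob_compl_eq_one_sub (measurableSet_singleton _)]
        simp
      · intro t
        simp only [Pi.zero_apply, sub_nonneg]
        exact Real.exp_le_one_iff.mpr (by nlinarith [sq_nonneg t])
      · exact (integrable_const _).sub hint
    rw [integral_sub (integrable_const _) hint] at hpos
    simp at hpos
    linarith
  refine ⟨- Real.log ρ / 2, by linarith [Real.log_neg hρ0 hρ1], ?_⟩
  intro ι _
  set c := - Real.log ρ / 2 with hc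
  have hprod : ∫ g, Real.exp (-1 * ∑ i, (g i) ^ 2) ∂(stdG ι) = ρ ^ (Fintype.card ι) := by
    have : ∀ g : ι → ℝ, Real.exp (-1 * ∑ i, (g i) ^ 2) = ∏ i, Real.exp (- (g i) ^ 2) := by
      intro g
      rw [← Real.exp_sum]; congr 1; simp
    simp_rw [this]
    unfold stdG
    rw [integral_fintype_prod_eq_prod (μ := fun _ : ι => gaussianReal 0 1)
      (f := fun _ t => Real.exp (- t ^ 2))]
    simp [hρ]
  have := measure_le_le_exp_mul_mgf (μ := stdG ι) (X := fun g => ∑ i, (g i) ^ 2) (t := -1)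
    (c * Fintype.card ι) (by norm_num) (by
      refine Integrable.of_bound (Measurable.aestronglyMeasurable (by fun_prop)) 1
        (ae_of_all _ fun t => ?_)
      rw [Real.norm_eq_abs, abs_of_nonneg (Real.exp_pos _).le]
      exact Real.exp_le_one_iff.mpr (by
        have : 0 ≤ ∑ i, (t i) ^ 2 := Finset.sum_nonneg fun i _ => sq_nonneg _
        linarith))
  refine this.trans ?_
  unfold mgf
  rw [hprod, ← Real.exp_log hρ0, ← Real.exp_nat_mul, ← Real.exp_add]
  apply Real.exp_le_exp.mpr
  have : Real.log ρ = -2 * c := by rw [hc]; ring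
  rw [this]
  linarith

lemma typeOf_mem {k d : ℕ} (i : Fin k → Fin d) :
    typeOf i ∈ Finset.Nat.antidiagonalTuple d k := by
  rw [Finset.Nat.mem_antidiagonalTuple]
  unfold typeOf
  have := Finset.card_eq_sum_card_fiberwise (s := (Finset.univ : Finset (Fin k)))
    (t := (Finset.univ : Finset (Fin d))) (f := i) (fun _ _ => by simp)
  rw [← this]; simp

/-- the type as a multi-index -/
def mkT {k d : ℕ} (i : Fin k → Fin d) : MIdx d k := ⟨typeOf i, typeOf_mem i⟩

/-- the weight of a multi-index -/
def wtM {d k : ℕ} (κ : MIdx d k) : ℝ :=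
  Real.sqrt ((∏ a, (Nat.factorial (κ.1 a) : ℝ)) / (Nat.factorial k : ℝ))

lemma wtM_nonneg {d k : ℕ} (κ : MIdx d k) : 0 ≤ wtM κ := Real.sqrt_nonneg _

lemma wtM_le {d k : ℕ} (κ : MIdx d k) : wtM κ ≤ 1 := by
  unfold wtM
  rw [Real.sqrt_le_one]
  rw [div_le_one (by positivity)]
  have h := κ.2
  rw [Finset.Nat.mem_antidiagonalTuple] at h
  have h2 := Nat.le_of_dvd (Nat.factorial_pos _)
    (Nat.prod_factorial_dvd_factorial_sum Finset.univ κ.1)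
  rw [h] at h2
  exact_mod_cast h2

lemma iotaT_eq {d k : ℕ} (v : MIdx d k → ℝ) (i : Fin k → Fin d) :
    iotaT d k v i = wtM (mkT i) * v (mkT i) := by
  unfold iotaT
  rw [dif_pos (typeOf_mem i)]
  rfl

lemma typeOf_split {d k r : ℕ} (hr : r ≤ k) (i : Fin (k - r) → Fin d) (a : Fin r → Fin d)
    (c : Fin d) : typeOf (splitIdx d k r i a) c = typeOf i c + typeOf a c := by
  unfold typeOf
  simp only [Finset.card_filter]
  let e : Fin (k - r) ⊕ Fin r ≃ Fin k := finSumFinEquiv.trans (finCongr (by omega))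
  rw [← Equiv.sum_comp e, Fintype.sum_sum_type]
  congr 1
  · refine Finset.sum_congr rfl fun t _ => ?_
    have : splitIdx d k r i a (e (Sum.inl t)) = i t := by
      simp [splitIdx, e]
    rw [this]
  · refine Finset.sum_congr rfl fun t _ => ?_
    have : splitIdx d k r i a (e (Sum.inr t)) = a t := by
      simp [splitIdx, e]
    rw [this]

/-- add a multi-index to a type -/
def addM {d k r : ℕ} (hr : r ≤ k) (i : Fin (k - r) → Fin d) (α : MIdx d r) : MIdx d k :=
  ⟨fun c => typeOf i c + α.1 c, by
    have h1 := typeOf_mem i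
    have h2 := α.2
    rw [Finset.Nat.mem_antidiagonalTuple] at h1 h2 ⊢
    rw [Finset.sum_add_distrib, h1, h2]; omega⟩

lemma mkT_split {d k r : ℕ} (hr : r ≤ k) (i : Fin (k - r) → Fin d) (a : Fin r → Fin d) :
    mkT (splitIdx d k r i a) = addM hr i (mkT a) := by
  apply Subtype.ext
  funext c
  exact typeOf_split hr i a c

lemma fiber_card {d n : ℕ} (κ : Fin d → ℕ) :
    (Finset.univ.filter fun b : Fin n → Fin d => typeOf b = κ).card ≤ n ^ n := by
  rcases (Finset.univ.filter fun b : Fin n → Fin d => typeOf b = κ).eq_empty_or_nonempty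
    with h | ⟨a, ha⟩
  · rw [h]; simp
  · rw [Finset.mem_filter] at ha
    have hsub : (Finset.univ.filter fun b : Fin n → Fin d => typeOf b = κ) ⊆
        Fintype.piFinset (fun _ : Fin n => Finset.univ.image a) := by
      intro b hb
      rw [Finset.mem_filter] at hb
      rw [Fintype.mem_piFinset]
      intro t
      have h1 : typeOf a (b t) = typeOf b (b t) := by rw [ha.2, hb.2]
      have h2 : 0 < typeOf b (b t) := Finset.card_pos.mpr ⟨t, by simp⟩
      rw [← h1] at h2
      obtain ⟨u, hu⟩ := Finset.card_pos.mp h2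
      rw [Finset.mem_filter] at hu
      exact Finset.mem_image.mpr ⟨u, by simp, hu.2⟩
    refine (Finset.card_le_card hsub).trans ?_
    rw [Fintype.card_piFinset]
    simp only [Finset.prod_const, Finset.card_univ, Fintype.card_fin]
    apply Nat.pow_le_pow_left
    exact Finset.card_image_le.trans (by simp)

lemma self_pow_le {n k : ℕ} (h : n ≤ k) : n ^ n ≤ k ^ k := by
  rcases Nat.eq_zero_or_pos k with rfl | hk
  · have : n = 0 := by omega
    subst this; simp
  · exact (Nat.pow_le_pow_left h n).trans (Nat.pow_le_pow_right hk h)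

lemma card_MIdx (d k : ℕ) : d ^ k ≤ k ^ k * Fintype.card (MIdx d k) := by
  have h := Finset.card_le_mul_card_image_of_maps_to
    (s := (Finset.univ : Finset (Fin k → Fin d))) (t := (Finset.univ : Finset (MIdx d k)))
    (f := mkT) (fun _ _ => by simp) (k ^ k) (fun κ _ => by
      have := fiber_card (n := k) κ.1
      refine le_trans (le_of_eq ?_) this
      congr 1
      ext b
      simp [mkT, Subtype.ext_iff])
  simpa using h

/-- the coefficients of the grouped sum -/
def coefM {d k r : ℕ} (hr : r ≤ k) (i j : Fin (k - r) → Fin d) (α : MIdx d r) : ℝ :=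
  ((Finset.univ.filter fun a : Fin r → Fin d => mkT a = α).card : ℝ) *
    (wtM (addM hr i α) * wtM (addM hr j α))

lemma coefM_le {d k r : ℕ} (hr : r ≤ k) (i j : Fin (k - r) → Fin d) (α : MIdx d r) :
    |coefM hr i j α| ≤ (k : ℝ) ^ k := by
  unfold coefM
  have h0 := wtM_nonneg (addM hr i α)
  have h1 := wtM_nonneg (addM hr j α)
  rw [abs_of_nonneg (by positivity)]
  have h2 : wtM (addM hr i α) * wtM (addM hr j α) ≤ 1 :=
    mul_le_one₀ (wtM_le _) h1 (wtM_le _)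
  have h3 : (Finset.univ.filter fun a : Fin r → Fin d => mkT a = α).card ≤ k ^ k := by
    refine le_trans (le_of_eq ?_) ((fiber_card (n := r) α.1).trans (self_pow_le hr))
    congr 1
    ext b
    simp [mkT, Subtype.ext_iff]
  have h3' : ((Finset.univ.filter fun a : Fin r → Fin d => mkT a = α).card : ℝ) ≤ (k : ℝ) ^ k := by
    exact_mod_cast h3
  calc _ ≤ (k : ℝ) ^ k * 1 := mul_le_mul h3' h2 (by positivity) (by positivity)
    _ = _ := mul_one _

lemma grouped {d k r : ℕ} (hr : r ≤ k) (i j : Fin (k - r) → Fin d) (v : MIdx d k → ℝ) :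
    ∑ a : Fin r → Fin d, iotaT d k v (splitIdx d k r i a) * iotaT d k v (splitIdx d k r j a) =
    ∑ α ∈ Finset.univ.image (mkT : (Fin r → Fin d) → MIdx d r),
      coefM hr i j α * (v (addM hr i α) * v (addM hr j α)) := by
  have h := Finset.sum_comp (s := (Finset.univ : Finset (Fin r → Fin d)))
    (fun α : MIdx d r => (wtM (addM hr i α) * v (addM hr i α)) *
      (wtM (addM hr j α) * v (addM hr j α))) mkT
  simp only [iotaT_eq, mkT_split hr]
  rw [h]
  refine Finset.sum_congr rfl fun α _ => ?_
  unfold coefM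
  rw [nsmul_eq_mul]
  ring

lemma offdiag_tail {d k r : ℕ} (hd : 0 < d) (hk : 0 < k) (hr : r < k)
    (i j : Fin (k - r) → Fin d) (hij : typeOf i ≠ typeOf j)
    (φ : ℝ → ℝ) (hφ : Measurable φ)
    (hodd : ∀ t, φ (-t) = - φ t) (K : ℝ) (hK0 : 0 < K) (hK : ∀ t, |φ t| ≤ K)
    (t : ℝ) (ht : 0 < t) :
    (stdG (MIdx d k)).real {g | k * (t * (Real.sqrt ((d : ℝ) ^ r) * ((k : ℝ) ^ k * K ^ 2))) ≤
      |∑ a : Fin r → Fin d, iotaT d k (fun x => φ (g x)) (splitIdx d k r i a) *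
        iotaT d k (fun x => φ (g x)) (splitIdx d k r j a)|} ≤
      k * (2 * Real.exp (- t ^ 2 / 2)) := by
  obtain ⟨c0, hc0⟩ := Function.ne_iff.mp hij
  set I := Finset.univ.image (mkT : (Fin r → Fin d) → MIdx d r) with hI
  have hIcard : (I.card : ℝ) ≤ (d : ℝ) ^ r := by
    have : I.card ≤ d ^ r := Finset.card_image_le.trans (by simp)
    exact_mod_cast this
  let A : NNReal := ⟨(k : ℝ) ^ k * K ^ 2, by positivity⟩
  have hAe : (A : ℝ) = (k : ℝ) ^ k * K ^ 2 := rfl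
  have hA0 : 0 < A := by
    rw [← NNReal.coe_pos, hAe]; positivity
  let Sm : ℕ → (MIdx d k → ℝ) → ℝ := fun s g => ∑ α ∈ I.filter (fun α => α.1 c0 = s),
    coefM hr.le i j α * (φ (g (addM hr.le i α)) * φ (g (addM hr.le j α)))
  have htail : ∀ s, (stdG (MIdx d k)).real
      {g | t * (Real.sqrt ((d : ℝ) ^ r) * A) ≤ |Sm s g|} ≤ 2 * Real.exp (- t ^ 2 / 2) := by
    intro s
    refine tail_sum φ hφ hodd K hK (addM hr.le i) (addM hr.le j) (coefM hr.le i j) A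
      (fun α => ?_) _ ?_ ?_ _ ?_ hA0 (by positivity) t ht
    · rw [hAe]
      exact mul_le_mul_of_nonneg_right (coefM_le _ _ _ _) (by positivity)
    · intro α _ h
      have := congrFun (congrArg Subtype.val h) c0
      simp only [addM] at this
      omega
    · intro α hα β hβ hne
      rw [Finset.mem_filter] at hα hβ
      refine ⟨fun h => hne ?_, fun h => ?_, fun h => hne ?_⟩
      · apply Subtype.ext; funext c
        have := congrFun (congrArg Subtype.val h) c
        simp only [addM] at this
        omega
      · have := congrFun (congrArg Subtype.val h) c0
        simp only [addM] at this
        omega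
      · apply Subtype.ext; funext c
        have := congrFun (congrArg Subtype.val h) c
        simp only [addM] at this
        omega
    · refine le_trans ?_ hIcard
      exact_mod_cast Finset.card_filter_le _ _
  have hsum : ∀ g, ∑ a : Fin r → Fin d, iotaT d k (fun x => φ (g x)) (splitIdx d k r i a) *
        iotaT d k (fun x => φ (g x)) (splitIdx d k r j a) = ∑ s ∈ Finset.range k, Sm s g := by
    intro g
    rw [grouped hr.le]
    rw [Finset.sum_fiberwise_of_maps_to (s := I) (t := Finset.range k) (g := fun α => α.1 c0)]
    intro α _
    have h2 := α.2
    rw [Finset.Nat.mem_antidiagonalTuple] at h2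
    rw [Finset.mem_range]
    have := Finset.single_le_sum (f := α.1) (fun _ _ => Nat.zero_le _) (Finset.mem_univ c0)
    omega
  have hsub : {g | k * (t * (Real.sqrt ((d : ℝ) ^ r) * ((k : ℝ) ^ k * K ^ 2))) ≤
      |∑ a : Fin r → Fin d, iotaT d k (fun x => φ (g x)) (splitIdx d k r i a) *
        iotaT d k (fun x => φ (g x)) (splitIdx d k r j a)|} ⊆
      ⋃ s ∈ Finset.range k, {g | t * (Real.sqrt ((d : ℝ) ^ r) * A) ≤ |Sm s g|} := by
    intro g hg
    rw [Set.mem_ofPred_eq, hsum g, ← hAe] at hg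
    by_contra hcon
    simp only [Set.mem_iUnion, Set.mem_ofPred_eq, not_exists, not_le] at hcon
    have h1 : |∑ s ∈ Finset.range k, Sm s g| <
        ∑ s ∈ Finset.range k, t * (Real.sqrt ((d : ℝ) ^ r) * A) :=
      (Finset.abs_sum_le_sum_abs _ _).trans_lt
        (Finset.sum_lt_sum_of_nonempty ⟨0, by simpa using hk⟩ hcon)
    rw [Finset.sum_const, Finset.card_range, nsmul_eq_mul] at h1
    linarith
  calc _ ≤ _ := measureReal_mono hsub (measure_ne_top _ _)
    _ ≤ _ := measureReal_biUnion_finset_le _ _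
    _ ≤ ∑ s ∈ Finset.range k, 2 * Real.exp (- t ^ 2 / 2) := Finset.sum_le_sum fun s _ => htail s
    _ = _ := by simp

lemma det_bound {d k r : ℕ} (hr : r ≤ k) (g : MIdx d k → ℝ) (K M : ℝ)
    (h1 : ∀ i : Fin k → Fin d, |g (mkT i)| ≤ K)
    (h2 : ∀ i j : Fin (k - r) → Fin d, typeOf i ≠ typeOf j →
      |∑ a : Fin r → Fin d, iotaT d k g (splitIdx d k r i a) *
        iotaT d k g (splitIdx d k r j a)| ≤ M) :
    contrNormSq d k r (iotaT d k g) (iotaT d k g) ≤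
      ((d : ℝ) ^ (k - r)) ^ 2 * M ^ 2 + (d : ℝ) ^ (k - r) * (k : ℝ) ^ k * ((d : ℝ) ^ r * K ^ 2) ^ 2 := by
  have hS : ∀ i, |iotaT d k g i| ≤ K := by
    intro i
    rw [iotaT_eq, abs_mul, abs_of_nonneg (wtM_nonneg _)]
    calc _ ≤ 1 * |g (mkT i)| := mul_le_mul_of_nonneg_right (wtM_le _) (abs_nonneg _)
      _ ≤ K := by rw [one_mul]; exact h1 i
  have hall : ∀ i j : Fin (k - r) → Fin d,
      |∑ a : Fin r → Fin d, iotaT d k g (splitIdx d k r i a) *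
        iotaT d k g (splitIdx d k r j a)| ≤ (d : ℝ) ^ r * K ^ 2 := by
    intro i j
    calc _ ≤ ∑ a : Fin r → Fin d, |iotaT d k g (splitIdx d k r i a) *
        iotaT d k g (splitIdx d k r j a)| := Finset.abs_sum_le_sum_abs _ _
      _ ≤ ∑ a : Fin r → Fin d, K ^ 2 := by
        refine Finset.sum_le_sum fun a _ => ?_
        rw [abs_mul, pow_two]
        exact mul_le_mul (hS _) (hS _) (abs_nonneg _) ((abs_nonneg _).trans (hS (splitIdx d k r i a)))
      _ = _ := by simp
  unfold contrNormSq
  rw [Fintype.sum_prod_type]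
  calc _ ≤ ∑ i : Fin (k - r) → Fin d, ∑ j : Fin (k - r) → Fin d,
        (M ^ 2 + if typeOf j = typeOf i then ((d : ℝ) ^ r * K ^ 2) ^ 2 else 0) := by
        refine Finset.sum_le_sum fun i _ => Finset.sum_le_sum fun j _ => ?_
        by_cases h : typeOf j = typeOf i
        · rw [if_pos h]
          have := sq_le_sq' (abs_le.mp (hall i j)).1 (abs_le.mp (hall i j)).2
          dsimp only
          nlinarith [sq_nonneg M]
        · rw [if_neg h, add_zero]
          have h' := h2 i j (fun e => h e.symm)
          exact sq_le_sq' (abs_le.mp h').1 (abs_le.mp h').2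
    _ ≤ ∑ i : Fin (k - r) → Fin d,
        ((d : ℝ) ^ (k - r) * M ^ 2 + (k : ℝ) ^ k * ((d : ℝ) ^ r * K ^ 2) ^ 2) := by
        refine Finset.sum_le_sum fun i _ => ?_
        rw [Finset.sum_add_distrib]
        refine add_le_add (le_of_eq (by simp)) ?_
        rw [← Finset.sum_filter, Finset.sum_const, nsmul_eq_mul]
        refine mul_le_mul_of_nonneg_right ?_ (by positivity)
        exact_mod_cast (fiber_card (n := k - r) (typeOf i)).trans (self_pow_le (by omega))
    _ = _ := by
        rw [Finset.sum_const, nsmul_eq_mul]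
        simp
        ring

lemma contr_smul {d k r : ℕ} (c : ℝ) (g : MIdx d k → ℝ) :
    contrNormSq d k r (iotaT d k (c • g)) (iotaT d k (c • g)) =
      (c ^ 2) ^ 2 * contrNormSq d k r (iotaT d k g) (iotaT d k g) := by
  unfold contrNormSq
  rw [Finset.mul_sum]
  refine Finset.sum_congr rfl fun ij _ => ?_
  rw [← mul_pow, Finset.mul_sum]
  congr 1
  refine Finset.sum_congr rfl fun a _ => ?_
  simp only [iotaT_eq, Pi.smul_apply, smul_eq_mul]
  ring

lemma good_event (k : ℕ) (hk : 2 ≤ k) : ∃ c : ℝ, 0 < c ∧ ∀ d : ℕ, 0 < d → ∀ K : ℝ, 0 < K →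
    ∃ bad : Set (MIdx d k → ℝ),
      (stdG (MIdx d k)).real bad ≤
        (2 + 2 * (k : ℝ) ^ 2) * (d : ℝ) ^ (2 * k) * Real.exp (- K ^ 2 / 2) +
          Real.exp (- c * (d : ℝ) ^ k) ∧
      ∀ g, g ∉ bad → c * (d : ℝ) ^ k < ∑ x, (g x) ^ 2 ∧ ∀ r : ℕ, r < k →
        contrNormSq d k r (iotaT d k g) (iotaT d k g) ≤
        ((d : ℝ) ^ (k - r)) ^ 2 *
          (k * (K * (Real.sqrt ((d : ℝ) ^ r) * ((k : ℝ) ^ k * K ^ 2)))) ^ 2 +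
          (d : ℝ) ^ (k - r) * (k : ℝ) ^ k * ((d : ℝ) ^ r * K ^ 2) ^ 2 := by
  obtain ⟨c0, hc0, hlow⟩ := exists_lower
  have hk0 : (0 : ℝ) < k := by exact_mod_cast (by omega : 0 < k)
  refine ⟨c0 / (k : ℝ) ^ k, by positivity, ?_⟩
  intro d hd K hK
  have hd1 : (1 : ℝ) ≤ d := by exact_mod_cast hd
  let φ : ℝ → ℝ := fun t => if |t| ≤ K then t else 0
  have hφm : Measurable φ :=
    Measurable.ite (measurableSet_le (by fun_prop) (by fun_prop)) measurable_id measurable_const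
  have hodd : ∀ t, φ (-t) = - φ t := by
    intro t
    simp only [φ, abs_neg]
    split_ifs <;> simp
  have hφK : ∀ t, |φ t| ≤ K := by
    intro t
    simp only [φ]
    split_ifs with h
    · exact h
    · simpa using hK.le
  let M : ℕ → ℝ := fun r => k * (K * (Real.sqrt ((d : ℝ) ^ r) * ((k : ℝ) ^ k * K ^ 2)))
  let B1 : Set (MIdx d k → ℝ) :=
    ⋃ i ∈ (Finset.univ : Finset (Fin k → Fin d)), {g | K ≤ |g (mkT i)|}
  let P : (r : ℕ) → Finset ((Fin (k - r) → Fin d) × (Fin (k - r) → Fin d)) := fun r =>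
    Finset.univ.filter fun p => typeOf p.1 ≠ typeOf p.2
  let E : (r : ℕ) → ((Fin (k - r) → Fin d) × (Fin (k - r) → Fin d)) →
      Set (MIdx d k → ℝ) := fun r p => {g | M r ≤
      |∑ a : Fin r → Fin d, iotaT d k (fun x => φ (g x)) (splitIdx d k r p.1 a) *
        iotaT d k (fun x => φ (g x)) (splitIdx d k r p.2 a)|}
  let B2 : Set (MIdx d k → ℝ) := ⋃ r ∈ Finset.range k, ⋃ p ∈ P r, E r p
  let B3 : Set (MIdx d k → ℝ) := {g | ∑ x, (g x) ^ 2 ≤ c0 * Fintype.card (MIdx d k)}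
  have hcard : c0 / (k : ℝ) ^ k * (d : ℝ) ^ k ≤ c0 * Fintype.card (MIdx d k) := by
    have := card_MIdx d k
    have h' : (d : ℝ) ^ k ≤ (k : ℝ) ^ k * Fintype.card (MIdx d k) := by exact_mod_cast this
    rw [div_mul_eq_mul_div, div_le_iff₀ (by positivity)]
    nlinarith
  have hexp := Real.exp_pos (- K ^ 2 / 2)
  have hb1 : (stdG (MIdx d k)).real B1 ≤ (d : ℝ) ^ (2 * k) * (2 * Real.exp (- K ^ 2 / 2)) := by
    calc _ ≤ _ := measureReal_biUnion_finset_le _ _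
      _ ≤ ∑ i : Fin k → Fin d, 2 * Real.exp (- K ^ 2 / 2) :=
        Finset.sum_le_sum fun i _ => tail_gauss _ K hK.le
      _ = (d : ℝ) ^ k * (2 * Real.exp (- K ^ 2 / 2)) := by simp
      _ ≤ _ := by
        apply mul_le_mul_of_nonneg_right _ (by positivity)
        exact pow_le_pow_right₀ hd1 (by omega)
  have hb2 : (stdG (MIdx d k)).real B2 ≤
      k * ((d : ℝ) ^ (2 * k) * (k * (2 * Real.exp (- K ^ 2 / 2)))) := by
    calc _ ≤ _ := measureReal_biUnion_finset_le _ _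
      _ ≤ ∑ r ∈ Finset.range k, ((d : ℝ) ^ (2 * k) * (k * (2 * Real.exp (- K ^ 2 / 2)))) := by
        refine Finset.sum_le_sum fun r hr => ?_
        rw [Finset.mem_range] at hr
        calc _ ≤ _ := measureReal_biUnion_finset_le _ _
          _ ≤ ∑ p ∈ P r, k * (2 * Real.exp (- K ^ 2 / 2)) := by
            refine Finset.sum_le_sum fun p hp => ?_
            exact offdiag_tail hd (by omega) hr p.1 p.2 (Finset.mem_filter.mp hp).2 φ hφm hodd K hK
              hφK K hK
          _ = ((P r).card : ℝ) * (k * (2 * Real.exp (- K ^ 2 / 2))) := by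
            rw [Finset.sum_const, nsmul_eq_mul]
          _ ≤ _ := by
            apply mul_le_mul_of_nonneg_right _ (by positivity)
            have h1 : (P r).card ≤ d ^ (k - r) * d ^ (k - r) := by
              refine (Finset.card_filter_le _ _).trans ?_
              simp
            have h2 : ((P r).card : ℝ) ≤ (d : ℝ) ^ (k - r) * (d : ℝ) ^ (k - r) := by
              exact_mod_cast h1
            refine h2.trans ?_
            rw [← pow_add]
            exact pow_le_pow_right₀ hd1 (by omega)
      _ = _ := by simp
  have hb3 : (stdG (MIdx d k)).real B3 ≤ Real.exp (- (c0 / (k : ℝ) ^ k) * (d : ℝ) ^ k) := by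
    refine (hlow (MIdx d k)).trans ?_
    apply Real.exp_le_exp.mpr
    linarith
  refine ⟨B1 ∪ B2 ∪ B3, ?_, ?_⟩
  · have := measureReal_union_le (μ := stdG (MIdx d k)) (B1 ∪ B2) B3
    have := measureReal_union_le (μ := stdG (MIdx d k)) B1 B2
    have e : (2 + 2 * (k : ℝ) ^ 2) * (d : ℝ) ^ (2 * k) * Real.exp (- K ^ 2 / 2) =
      (d : ℝ) ^ (2 * k) * (2 * Real.exp (- K ^ 2 / 2)) +
      k * ((d : ℝ) ^ (2 * k) * (k * (2 * Real.exp (- K ^ 2 / 2)))) := by ring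
    rw [e]
    linarith
  · intro g hg
    rw [Set.mem_union, Set.mem_union, not_or, not_or] at hg
    obtain ⟨⟨h1, h2⟩, h3⟩ := hg
    have h1' : ∀ i : Fin k → Fin d, |g (mkT i)| < K := by
      intro i
      by_contra hcon
      exact h1 (Set.mem_biUnion (Finset.mem_univ i) (not_lt.mp hcon))
    have h3' : c0 * Fintype.card (MIdx d k) < ∑ x, (g x) ^ 2 := not_le.mp h3
    refine ⟨hcard.trans_lt h3', fun r hr => ?_⟩
    have hio : iotaT d k (fun x => φ (g x)) = iotaT d k g := by
      funext i
      rw [iotaT_eq, iotaT_eq]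
      congr 1
      simp only [φ]
      rw [if_pos (h1' i).le]
    refine det_bound hr.le g K (M r) (fun i => (h1' i).le) (fun i j hij => ?_)
    by_contra hcon
    apply h2
    have hmem : g ∈ E r (i, j) := by
      change M r ≤ _
      dsimp only
      rw [hio]
      exact (not_le.mp hcon).le
    exact Set.mem_biUnion (Finset.mem_range.mpr hr)
      (Set.mem_biUnion (Finset.mem_filter.mpr ⟨Finset.mem_univ (i, j), hij⟩) hmem)

lemma contr_numeric (k : ℕ) (hk : 2 ≤ k) (d : ℕ) (hd : 0 < d) (ε : ℝ) (hε : 0 < ε)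
    (r : ℕ) (hr1 : 1 ≤ r) (hr : r < k) :
    ((d : ℝ) ^ (k - r)) ^ 2 *
          (k * ((d : ℝ) ^ ε * (Real.sqrt ((d : ℝ) ^ r) * ((k : ℝ) ^ k * ((d : ℝ) ^ ε) ^ 2)))) ^ 2 +
          (d : ℝ) ^ (k - r) * (k : ℝ) ^ k * ((d : ℝ) ^ r * ((d : ℝ) ^ ε) ^ 2) ^ 2 ≤
      2 * (k : ℝ) ^ (2 * k + 2) * ((d : ℝ) ^ (2 * k) * (d : ℝ) ^ (-1 + 6 * ε)) := by
  have hd1 : (1 : ℝ) ≤ d := by exact_mod_cast hd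
  have hd0 : (0 : ℝ) < d := by linarith
  have hk1 : (1 : ℝ) ≤ k := by exact_mod_cast (by omega : 1 ≤ k)
  set q := (d : ℝ) ^ ε with hq
  have hq1 : 1 ≤ q := Real.one_le_rpow hd1 hε.le
  have e6 : (d : ℝ) ^ (-1 + 6 * ε) = (d : ℝ)⁻¹ * q ^ 6 := by
    rw [Real.rpow_add hd0, Real.rpow_neg_one, mul_comm 6 ε, Real.rpow_mul hd0.le, hq]
    norm_cast
  have e2k : (d : ℝ) ^ (2 * k) * (d : ℝ) ^ (-1 + 6 * ε) = (d : ℝ) ^ (2 * k - 1) * q ^ 6 := by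
    rw [e6, ← mul_assoc]
    congr 1
    rw [mul_inv_eq_iff_eq_mul₀ hd0.ne', ← pow_succ]
    congr 1; omega
  rw [e2k]
  have t1 : ((d : ℝ) ^ (k - r)) ^ 2 *
          (k * (q * (Real.sqrt ((d : ℝ) ^ r) * ((k : ℝ) ^ k * q ^ 2)))) ^ 2 =
      (k : ℝ) ^ (2 * k + 2) * ((d : ℝ) ^ (2 * (k - r) + r) * q ^ 6) := by
    have hs := Real.sq_sqrt (by positivity : (0 : ℝ) ≤ (d : ℝ) ^ r)
    have : ((d : ℝ) ^ (k - r)) ^ 2 *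
          (k * (q * (Real.sqrt ((d : ℝ) ^ r) * ((k : ℝ) ^ k * q ^ 2)))) ^ 2 =
        ((d : ℝ) ^ (k - r)) ^ 2 * (k ^ 2 * (q ^ 6 * (Real.sqrt ((d : ℝ) ^ r) ^ 2 *
          ((k : ℝ) ^ k) ^ 2))) := by ring
    rw [this, hs]; ring
  have t2 : (d : ℝ) ^ (k - r) * (k : ℝ) ^ k * ((d : ℝ) ^ r * q ^ 2) ^ 2 =
      (k : ℝ) ^ k * ((d : ℝ) ^ (k - r + 2 * r) * q ^ 4) := by ring
  rw [t1, t2]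
  have a1 : (d : ℝ) ^ (2 * (k - r) + r) ≤ (d : ℝ) ^ (2 * k - 1) :=
    pow_le_pow_right₀ hd1 (by omega)
  have a2 : (d : ℝ) ^ (k - r + 2 * r) ≤ (d : ℝ) ^ (2 * k - 1) :=
    pow_le_pow_right₀ hd1 (by omega)
  have a3 : q ^ 4 ≤ q ^ 6 := pow_le_pow_right₀ hq1 (by omega)
  have a4 : (k : ℝ) ^ k ≤ (k : ℝ) ^ (2 * k + 2) := pow_le_pow_right₀ hk1 (by omega)
  have b1 : (k : ℝ) ^ (2 * k + 2) * ((d : ℝ) ^ (2 * (k - r) + r) * q ^ 6) ≤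
      (k : ℝ) ^ (2 * k + 2) * ((d : ℝ) ^ (2 * k - 1) * q ^ 6) := by gcongr
  have b2 : (k : ℝ) ^ k * ((d : ℝ) ^ (k - r + 2 * r) * q ^ 4) ≤
      (k : ℝ) ^ (2 * k + 2) * ((d : ℝ) ^ (2 * k - 1) * q ^ 6) := by gcongr
  linarith

open Filter Topology in
lemma prob_eventually (k : ℕ) (hk : 2 ≤ k) (C c ε : ℝ) (hc : 0 < c) (hε : 0 < ε) :
    ∀ᶠ d : ℕ in atTop, (2 + 2 * (k : ℝ) ^ 2) * (d : ℝ) ^ (2 * k) *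
      Real.exp (- ((d : ℝ) ^ ε) ^ 2 / 2) + Real.exp (- c * (d : ℝ) ^ k) ≤ (d : ℝ) ^ (-C) := by
  have hcast : Tendsto (fun d : ℕ => (d : ℝ)) atTop atTop := tendsto_natCast_atTop_atTop
  have hpow : Tendsto (fun d : ℕ => ((d : ℝ) ^ (2 * ε))) atTop atTop :=
    (tendsto_rpow_atTop (by positivity)).comp hcast
  have h1 := (isLittleO_exp_neg_mul_rpow_atTop (a := 1 / 2) (by norm_num)
    ((-C - 2 * k) / (2 * ε))).comp_tendsto hpow
  have h2 := (isLittleO_exp_neg_mul_rpow_atTop hc (-C)).comp_tendsto hcast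
  have hA : 0 < (2 * (2 + 2 * (k : ℝ) ^ 2))⁻¹ := by positivity
  have b1 := h1.bound hA
  have b2 := h2.bound (by norm_num : (0 : ℝ) < 1 / 2)
  filter_upwards [b1, b2, eventually_ge_atTop 1] with d hb1 hb2 hd
  have hd1 : (1 : ℝ) ≤ d := by exact_mod_cast hd
  have hd0 : (0 : ℝ) < d := by linarith
  simp only [Function.comp] at hb1 hb2
  rw [Real.norm_of_nonneg (Real.exp_pos _).le, Real.norm_of_nonneg (by positivity)] at hb1 hb2
  rw [← Real.rpow_mul hd0.le, mul_div_cancel₀ _ (by positivity)] at hb1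
  have e1 : - ((d : ℝ) ^ ε) ^ 2 / 2 = -(1 / 2) * (d : ℝ) ^ (2 * ε) := by
    rw [mul_comm 2 ε, Real.rpow_mul hd0.le]; norm_cast; ring
  have e2 : (d : ℝ) ^ (-C - 2 * k) * (d : ℝ) ^ (2 * k) = (d : ℝ) ^ (-C) := by
    rw [← Real.rpow_natCast (d : ℝ) (2 * k), ← Real.rpow_add hd0]
    congr 1; push_cast; ring
  have e3 : Real.exp (- c * (d : ℝ) ^ k) ≤ Real.exp (- c * d) := by
    apply Real.exp_le_exp.mpr
    have : (d : ℝ) ≤ (d : ℝ) ^ k := le_self_pow₀ hd1 (by omega)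
    nlinarith
  rw [e1]
  have e4 : (2 + 2 * (k : ℝ) ^ 2) * (d : ℝ) ^ (2 * k) * Real.exp (-(1 / 2) * (d : ℝ) ^ (2 * ε)) ≤
      (2 + 2 * (k : ℝ) ^ 2) * (d : ℝ) ^ (2 * k) *
        ((2 * (2 + 2 * (k : ℝ) ^ 2))⁻¹ * (d : ℝ) ^ (-C - 2 * k)) := by gcongr
  have e5 : (2 + 2 * (k : ℝ) ^ 2) * (d : ℝ) ^ (2 * k) *
        ((2 * (2 + 2 * (k : ℝ) ^ 2))⁻¹ * (d : ℝ) ^ (-C - 2 * k)) = 1 / 2 * (d : ℝ) ^ (-C) := by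
    rw [← e2]; field_simp
  linarith

/-- **Lemma B.3**: if `β` is uniform on the unit sphere of `ℝ^{B_{d,k}}`, then with
probability at least `1 − d^{-C}` all nontrivial contractions of `ι(β)` with itself
have Frobenius norm at most `d^{-c'}`. -/
theorem uniform_coefficients_generic (k : ℕ) (hk : 2 ≤ k) (C c' : ℝ)
    (hC : 0 < C) (hc' : 0 < c') (hc'' : c' < 1 / 2) :
    ∃ d₀ : ℕ, 0 < d₀ ∧
      ∀ d : ℕ, d₀ ≤ d →
        1 - ENNReal.ofReal ((d : ℝ) ^ (-C)) ≤
          unifSphere (MIdx d k)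
            {β | ∀ r : ℕ, 1 ≤ r → r ≤ k - 1 →
              Real.sqrt (contrNormSq d k r (iotaT d k β) (iotaT d k β)) ≤ (d : ℝ) ^ (-c')} := by
  obtain ⟨c, hc, hgood⟩ := good_event k hk
  set ε : ℝ := (1 - 2 * c') / 12 with hεdef
  have hε : 0 < ε := by rw [hεdef]; linarith
  have hk0 : (0 : ℝ) < k := by exact_mod_cast (by omega : 0 < k)
  have hev1 := prob_eventually k hk C c ε hc hε
  have hev2 : ∀ᶠ d : ℕ in Filter.atTop,
      2 * (k : ℝ) ^ (2 * k + 2) / c ^ 2 ≤ (d : ℝ) ^ (6 * ε) :=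
    ((tendsto_rpow_atTop (by positivity : 0 < 6 * ε)).comp
      tendsto_natCast_atTop_atTop).eventually_ge_atTop _
  obtain ⟨d₁, hd₁⟩ := Filter.eventually_atTop.mp (hev1.and hev2)
  refine ⟨max d₁ 1, by simp, fun d hd => ?_⟩
  obtain ⟨hp, hl⟩ := hd₁ d (le_trans (le_max_left _ _) hd)
  have hd' : 0 < d := le_trans (le_max_right _ _) hd
  have hd0 : (0 : ℝ) < d := by exact_mod_cast hd'
  obtain ⟨bad, hbad, hcompl⟩ := hgood d hd' ((d : ℝ) ^ ε) (by positivity)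
  unfold unifSphere
  have hmeas : Measurable fun x : MIdx d k → ℝ => (enorm2 x)⁻¹ • x := by
    unfold enorm2
    fun_prop
  refine le_trans ?_ (Measure.le_map_apply hmeas.aemeasurable _)
  rw [tsub_le_iff_right]
  have hbad' : stdG (MIdx d k) bad ≤ ENNReal.ofReal ((d : ℝ) ^ (-C)) := by
    rw [← ofReal_measureReal]
    exact ENNReal.ofReal_le_ofReal (hbad.trans hp)
  refine le_trans ?_ (add_le_add_right hbad' _)
  refine le_trans ?_ (measure_union_le _ _)
  rw [← measure_univ (μ := stdG (MIdx d k))]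
  refine measure_mono fun g _ => ?_
  by_cases hg : g ∈ bad
  · exact Or.inr hg
  left
  obtain ⟨hQ, hcontr⟩ := hcompl g hg
  intro r hr1 hr2
  have hrk : r < k := by omega
  set Q := ∑ x, (g x) ^ 2 with hQdef
  have hQ0 : 0 < Q := lt_trans (by positivity) hQ
  have hen : ((enorm2 g)⁻¹) ^ 2 = Q⁻¹ := by
    unfold enorm2
    rw [inv_pow, Real.sq_sqrt hQ0.le]
  rw [contr_smul, hen]
  apply Real.sqrt_le_iff.mpr
  refine ⟨by positivity, ?_⟩
  have hb := (hcontr r hrk).trans (contr_numeric k hk d hd' ε hε r hr1 hrk)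
  have hQi : Q⁻¹ ≤ (c * (d : ℝ) ^ k)⁻¹ := inv_anti₀ (by positivity) hQ.le
  have e1 : ((d : ℝ) ^ (-c')) ^ 2 = (d : ℝ) ^ (6 * ε) * (d : ℝ) ^ (-1 + 6 * ε) := by
    rw [← Real.rpow_add hd0, ← Real.rpow_natCast, ← Real.rpow_mul hd0.le]
    congr 1
    rw [hεdef]; push_cast; ring
  calc _ ≤ Q⁻¹ ^ 2 * (2 * (k : ℝ) ^ (2 * k + 2) * ((d : ℝ) ^ (2 * k) * (d : ℝ) ^ (-1 + 6 * ε))) :=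
        mul_le_mul_of_nonneg_left hb (by positivity)
    _ ≤ ((c * (d : ℝ) ^ k)⁻¹) ^ 2 *
        (2 * (k : ℝ) ^ (2 * k + 2) * ((d : ℝ) ^ (2 * k) * (d : ℝ) ^ (-1 + 6 * ε))) := by gcongr
    _ = (2 * (k : ℝ) ^ (2 * k + 2) / c ^ 2) * (d : ℝ) ^ (-1 + 6 * ε) := by
        have : (d : ℝ) ^ (2 * k) = ((d : ℝ) ^ k) ^ 2 := by ring
        rw [this]
        field_simp
    _ ≤ (d : ℝ) ^ (6 * ε) * (d : ℝ) ^ (-1 + 6 * ε) := by gcongr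
    _ = _ := e1.symm
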